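/- In the setting of the previous statement (two representations of the same function in $\mathcal{Q}^{c_1,c_2,c_3}_\epsilon$ with $\beta(t_n)=0$), one has $|\beta''(t)|\le 2\pi\epsilon$, $|\beta'(t)|\le \frac{2\pi\epsilon}{c_1}$, and $|\beta(t)|\le\frac{2\pi\epsilon}{c_1^2}$ for all $t\in\mathbb{R}$ (for $\epsilon$ sufficiently small). -/

import Mathlib

open Real

theorem my_mono {f f' g g' : ℝ → ℝ} {p q : ℝ} (hpq : p ≤ q)
    (hf : ∀ x, HasDerivAt f (f' x) x) (hg : ∀ x, HasDerivAt g (g' x) x)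
    (h0 : f p ≤ g p) (h : ∀ x ∈ Set.Icc p q, f' x ≤ g' x) : f q ≤ g q := by
  have hd : ∀ x, HasDerivAt (fun x => g x - f x) (g' x - f' x) x := fun x => (hg x).sub (hf x)
  have : MonotoneOn (fun x => g x - f x) (Set.Icc p q) := by
    apply monotoneOn_of_deriv_nonneg (convex_Icc p q)
    · exact fun x _ => (hd x).continuousAt.continuousWithinAt
    · exact fun x _ => (hd x).differentiableAt.differentiableWithinAt
    · intro x hx
      rw [interior_Icc] at hx
      rw [(hd x).deriv]
      linarith [h x ⟨hx.1.le, hx.2.le⟩]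
  have := this (Set.left_mem_Icc.2 hpq) (Set.right_mem_Icc.2 hpq) hpq
  simp only at this
  linarith

theorem my_T1 {f f' : ℝ → ℝ} {p q K : ℝ} (hpq : p ≤ q)
    (hf : ∀ x, HasDerivAt f (f' x) x)
    (h : ∀ x ∈ Set.Icc p q, f' x ≤ K) : f q ≤ f p + K * (q - p) := by
  refine my_mono (g := fun s => f p + K * (s - p)) (g' := fun _ => K) hpq hf ?_ (by simp) h
  intro x
  have := (((hasDerivAt_id x).sub_const p).const_mul K).const_add (f p)
  simpa using this

theorem my_T2 {f f1 f2 : ℝ → ℝ} {p q K : ℝ} (hpq : p ≤ q)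
    (hf : ∀ x, HasDerivAt f (f1 x) x) (hf1 : ∀ x, HasDerivAt f1 (f2 x) x)
    (h : ∀ x ∈ Set.Icc p q, f2 x ≤ K) :
    f q ≤ f p + f1 p * (q - p) + K * (q - p) ^ 2 / 2 := by
  refine my_mono (g := fun s => f p + f1 p * (s - p) + K * (s - p) ^ 2 / 2)
    (g' := fun s => f1 p + K * (s - p)) hpq hf ?_ (by simp) ?_
  · intro x
    have h1 := (hasDerivAt_id x).sub_const p
    have := ((h1.const_mul (f1 p)).const_add (f p)).add (((h1.pow 2).const_mul K).div_const 2)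
    exact this.congr_deriv (by simp; ring)
  · intro x hx
    exact my_T1 hx.1 hf1 (fun y hy => h y ⟨hy.1, hy.2.trans hx.2⟩)

theorem my_T3 {f f1 f2 f3 : ℝ → ℝ} {p q K : ℝ} (hpq : p ≤ q)
    (hf : ∀ x, HasDerivAt f (f1 x) x) (hf1 : ∀ x, HasDerivAt f1 (f2 x) x)
    (hf2 : ∀ x, HasDerivAt f2 (f3 x) x)
    (h : ∀ x ∈ Set.Icc p q, f3 x ≤ K) :
    f q ≤ f p + f1 p * (q - p) + f2 p * (q - p) ^ 2 / 2 + K * (q - p) ^ 3 / 6 := by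
  refine my_mono (g := fun s => f p + f1 p * (s - p) + f2 p * (s - p) ^ 2 / 2 + K * (s - p) ^ 3 / 6)
    (g' := fun s => f1 p + f2 p * (s - p) + K * (s - p) ^ 2 / 2) hpq hf ?_ (by simp) ?_
  · intro x
    have h1 := (hasDerivAt_id x).sub_const p
    have := (((h1.const_mul (f1 p)).const_add (f p)).add
      (((h1.pow 2).const_mul (f2 p)).div_const 2)).add (((h1.pow 3).const_mul K).div_const 6)
    exact this.congr_deriv (by simp; ring)
  · intro x hx
    exact my_T2 hx.1 hf1 hf2 (fun y hy => h y ⟨hy.1, hy.2.trans hx.2⟩)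

theorem my_neg {f f' : ℝ → ℝ} (hf : ∀ x, HasDerivAt f (f' x) x) :
    ∀ x, HasDerivAt (fun s => - f s) (- f' x) x := fun x => (hf x).neg

theorem my_refl {f f' : ℝ → ℝ} (hf : ∀ x, HasDerivAt f (f' x) x) :
    ∀ x, HasDerivAt (fun s => f (-s)) (- f' (-x)) x := by
  intro x
  have := (hf (-x)).comp x (hasDerivAt_neg x)
  exact this.congr_deriv (by simp)

theorem my_A1 {f f1 : ℝ → ℝ} {p q K : ℝ} (hpq : p ≤ q)
    (hf : ∀ x, HasDerivAt f (f1 x) x)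
    (h : ∀ x ∈ Set.Icc p q, |f1 x| ≤ K) :
    |f q - f p| ≤ K * (q - p) := by
  have a := my_T1 hpq hf (fun x hx => (abs_le.1 (h x hx)).2)
  have b := my_T1 (K := K) hpq (my_neg hf) (fun x hx => by linarith [(abs_le.1 (h x hx)).1])
  rw [abs_le]; constructor <;> linarith

theorem my_A2 {f f1 f2 : ℝ → ℝ} {p q K : ℝ} (hpq : p ≤ q)
    (hf : ∀ x, HasDerivAt f (f1 x) x) (hf1 : ∀ x, HasDerivAt f1 (f2 x) x)
    (h : ∀ x ∈ Set.Icc p q, |f2 x| ≤ K) :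
    |f q - f p - f1 p * (q - p)| ≤ K * (q - p) ^ 2 / 2 := by
  have a := my_T2 hpq hf hf1 (fun x hx => (abs_le.1 (h x hx)).2)
  have b := my_T2 (K := K) hpq (my_neg hf) (my_neg hf1)
    (fun x hx => by linarith [(abs_le.1 (h x hx)).1])
  rw [abs_le]; constructor <;> linarith

theorem my_A3 {f f1 f2 f3 : ℝ → ℝ} {p q K : ℝ} (hpq : p ≤ q)
    (hf : ∀ x, HasDerivAt f (f1 x) x) (hf1 : ∀ x, HasDerivAt f1 (f2 x) x)
    (hf2 : ∀ x, HasDerivAt f2 (f3 x) x)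
    (h : ∀ x ∈ Set.Icc p q, |f3 x| ≤ K) :
    |f q - f p - f1 p * (q - p) - f2 p * (q - p) ^ 2 / 2| ≤ K * (q - p) ^ 3 / 6 := by
  have a := my_T3 hpq hf hf1 hf2 (fun x hx => (abs_le.1 (h x hx)).2)
  have b := my_T3 (K := K) hpq (my_neg hf) (my_neg hf1) (my_neg hf2)
    (fun x hx => by linarith [(abs_le.1 (h x hx)).1])
  rw [abs_le]; constructor <;> linarith

theorem my_B2 {f f1 f2 : ℝ → ℝ} {p q K : ℝ} (hpq : p ≤ q)
    (hf : ∀ x, HasDerivAt f (f1 x) x) (hf1 : ∀ x, HasDerivAt f1 (f2 x) x)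
    (h : ∀ x ∈ Set.Icc p q, |f2 x| ≤ K) :
    |f p - f q + f1 q * (q - p)| ≤ K * (q - p) ^ 2 / 2 := by
  have := my_A2 (K := K) (neg_le_neg hpq) (my_refl hf) (my_neg (my_refl hf1))
    (fun x hx => by
      have := h (-x) ⟨by linarith [hx.2], by linarith [hx.1]⟩
      simpa using this)
  simp only [neg_neg] at this
  convert this using 2 <;> ring

theorem my_B3 {f f1 f2 f3 : ℝ → ℝ} {p q K : ℝ} (hpq : p ≤ q)
    (hf : ∀ x, HasDerivAt f (f1 x) x) (hf1 : ∀ x, HasDerivAt f1 (f2 x) x)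
    (hf2 : ∀ x, HasDerivAt f2 (f3 x) x)
    (h : ∀ x ∈ Set.Icc p q, |f3 x| ≤ K) :
    |f p - f q + f1 q * (q - p) - f2 q * (q - p) ^ 2 / 2| ≤ K * (q - p) ^ 3 / 6 := by
  have := my_A3 (K := K) (neg_le_neg hpq) (my_refl hf) (my_neg (my_refl hf1))
    (my_neg (my_neg (my_refl hf2)))
    (fun x hx => by
      have := h (-x) ⟨by linarith [hx.2], by linarith [hx.1]⟩
      simpa using this)
  simp only [neg_neg] at this
  convert this using 2 <;> ring

theorem my_rolle {f f' : ℝ → ℝ} {p q : ℝ} (hpq : p < q)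
    (hf : ∀ x, HasDerivAt f (f' x) x) (h : f p = f q) : ∃ c ∈ Set.Ioo p q, f' c = 0 :=
  exists_hasDerivAt_eq_zero hpq (fun x _ => (hf x).continuousAt.continuousWithinAt) h
    (fun x _ => hf x)

theorem my_interp {f f1 f2 f3 : ℝ → ℝ} {p0 p1 p2 t : ℝ} (h01 : p0 < p1) (h1t : p1 < t)
    (ht2 : t < p2)
    (hf : ∀ x, HasDerivAt f (f1 x) x) (hf1 : ∀ x, HasDerivAt f1 (f2 x) x)
    (hf2 : ∀ x, HasDerivAt f2 (f3 x) x) (z0 : f p0 = 0) (z1 : f p1 = 0) (z2 : f p2 = 0) :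
    ∃ ξ ∈ Set.Icc p0 p2, f3 ξ * ((t - p0) * (t - p1) * (t - p2)) = 6 * f t := by
  set W := (t - p0) * (t - p1) * (t - p2) with hW
  set A := p0 + p1 + p2
  set B := p0 * p1 + p0 * p2 + p1 * p2
  have hg : ∀ x, HasDerivAt (fun s => f s * W - f t * (s ^ 3 - A * s ^ 2 + B * s - p0 * p1 * p2))
      (f1 x * W - f t * (3 * x ^ 2 - A * (2 * x) + B)) x := by
    intro x
    have h1 := hasDerivAt_id x
    have := ((hf x).mul_const W).sub (((((h1.pow 3).sub ((h1.pow 2).const_mul A)).add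
      (h1.const_mul B)).sub_const (p0 * p1 * p2)).const_mul (f t))
    exact this.congr_deriv (by simp)
  have hg1 : ∀ x, HasDerivAt (fun s => f1 s * W - f t * (3 * s ^ 2 - A * (2 * s) + B))
      (f2 x * W - f t * (6 * x - A * 2)) x := by
    intro x
    have h1 := hasDerivAt_id x
    have := ((hf1 x).mul_const W).sub (((((h1.pow 2).const_mul 3).sub
      ((h1.const_mul 2).const_mul A)).add_const B).const_mul (f t))
    exact this.congr_deriv (by simp; left; ring)
  have hg2 : ∀ x, HasDerivAt (fun s => f2 s * W - f t * (6 * s - A * 2))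
      (f3 x * W - f t * 6) x := by
    intro x
    have h1 := hasDerivAt_id x
    have := ((hf2 x).mul_const W).sub (((h1.const_mul 6).sub_const (A * 2)).const_mul (f t))
    exact this.congr_deriv (by simp)
  obtain ⟨a1, ha1, ea1⟩ := my_rolle h01 hg (by simp only [z0, z1, A, B]; ring)
  obtain ⟨a2, ha2, ea2⟩ := my_rolle h1t hg (by simp only [z1, A, B, hW]; ring)
  obtain ⟨a3, ha3, ea3⟩ := my_rolle ht2 hg (by simp only [z2, A, B, hW]; ring)
  obtain ⟨b1, hb1, eb1⟩ := my_rolle (ha1.2.trans ha2.1) hg1 (by simp only [ea1, ea2])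
  obtain ⟨b2, hb2, eb2⟩ := my_rolle (ha2.2.trans ha3.1) hg1 (by simp only [ea2, ea3])
  obtain ⟨c, hc, ec⟩ := my_rolle (hb1.2.trans hb2.1) hg2 (by simp only [eb1, eb2])
  refine ⟨c, ⟨?_, ?_⟩, by linarith⟩
  · linarith [ha1.1, hb1.1, hc.1]
  · linarith [ha3.2, hb2.2, hc.2]

/-- derivative bounds at a middle node -/
theorem my_node {f f1 f2 f3 : ℝ → ℝ} {p0 p1 p2 K h : ℝ} (hK : 0 ≤ K) (h01 : p0 < p1)
    (h12 : p1 < p2) (g1 : p1 - p0 ≤ h) (g2 : p2 - p1 ≤ h)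
    (hf : ∀ x, HasDerivAt f (f1 x) x) (hf1 : ∀ x, HasDerivAt f1 (f2 x) x)
    (hf2 : ∀ x, HasDerivAt f2 (f3 x) x) (z0 : f p0 = 0) (z1 : f p1 = 0) (z2 : f p2 = 0)
    (hb : ∀ x ∈ Set.Icc p0 p2, |f3 x| ≤ K) :
    |f1 p1| ≤ K * h ^ 2 / 6 ∧ |f2 p1| ≤ K * h / 3 := by
  have a := my_A3 h12.le hf hf1 hf2 (fun x hx => hb x ⟨h01.le.trans hx.1, hx.2⟩)
  have b := my_B3 h01.le hf hf1 hf2 (fun x hx => hb x ⟨hx.1, hx.2.trans h12.le⟩)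
  rw [z1, z2] at a
  rw [z0, z1] at b
  obtain ⟨u, hu⟩ : ∃ u, u = p1 - p0 := ⟨_, rfl⟩
  obtain ⟨v, hv⟩ : ∃ v, v = p2 - p1 := ⟨_, rfl⟩
  rw [← hu] at b g1
  rw [← hv] at a g2
  have u0 : 0 < u := by linarith
  have v0 : 0 < v := by linarith
  obtain ⟨a1, a2⟩ := abs_le.1 a
  obtain ⟨b1, b2⟩ := abs_le.1 b
  set X := f1 p1
  set Y := f2 p1
  -- divide by v and u
  have a1' : X + Y * v / 2 ≤ K * v ^ 2 / 6 := by
    refine le_of_mul_le_mul_right ?_ v0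
    nlinarith
  have a2' : -(K * v ^ 2 / 6) ≤ X + Y * v / 2 := by
    refine le_of_mul_le_mul_right ?_ v0
    nlinarith
  have b1' : -(K * u ^ 2 / 6) ≤ X - Y * u / 2 := by
    refine le_of_mul_le_mul_right ?_ u0
    nlinarith
  have b2' : X - Y * u / 2 ≤ K * u ^ 2 / 6 := by
    refine le_of_mul_le_mul_right ?_ u0
    nlinarith
  have huv : 0 < u + v := by linarith
  have e1 : u * v ≤ h ^ 2 := by nlinarith
  have e2 : u ^ 2 + v ^ 2 ≤ h * (u + v) := by nlinarith
  have k1 := mul_le_mul_of_nonneg_left e1 hK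
  have k2 := mul_le_mul_of_nonneg_left e2 hK
  have k1' : K * (u * v) * (u + v) ≤ K * h ^ 2 * (u + v) := mul_le_mul_of_nonneg_right k1 huv.le
  have p1 := mul_le_mul_of_nonneg_left a1' u0.le
  have p2 := mul_le_mul_of_nonneg_left a2' u0.le
  have p3 := mul_le_mul_of_nonneg_left b1' v0.le
  have p4 := mul_le_mul_of_nonneg_left b2' v0.le
  constructor
  · rw [abs_le]; constructor
    · refine le_of_mul_le_mul_right ?_ huv
      linarith
    · refine le_of_mul_le_mul_right ?_ huv
      linarith
  · rw [abs_le]; constructor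
    · refine le_of_mul_le_mul_right ?_ huv
      linarith
    · refine le_of_mul_le_mul_right ?_ huv
      linarith

theorem my_local {f f1 f2 f3 : ℝ → ℝ} {p0 p1 p2 p3 t K h : ℝ} (hK : 0 ≤ K) (h01 : p0 < p1)
    (h12 : p1 < p2) (h23 : p2 < p3) (g1 : p1 - p0 ≤ h) (g2 : p2 - p1 ≤ h) (g3 : p3 - p2 ≤ h)
    (ht1 : p1 ≤ t) (ht2 : t < p2)
    (hf : ∀ x, HasDerivAt f (f1 x) x) (hf1 : ∀ x, HasDerivAt f1 (f2 x) x)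
    (hf2 : ∀ x, HasDerivAt f2 (f3 x) x) (z0 : f p0 = 0) (z1 : f p1 = 0) (z2 : f p2 = 0)
    (z3 : f p3 = 0)
    (hb : ∀ x ∈ Set.Icc p0 p3, |f3 x| ≤ K) :
    |f2 t| ≤ K * h * (5 / 6) ∧ |f1 t| ≤ K * h ^ 2 * (7 / 24) ∧ |f t| ≤ K * h ^ 3 / 15 := by
  obtain ⟨n1, m1⟩ := my_node hK h01 h12 g1 g2 hf hf1 hf2 z0 z1 z2
    (fun x hx => hb x ⟨hx.1, hx.2.trans h23.le⟩)
  obtain ⟨n2, m2⟩ := my_node hK h12 h23 g2 g3 hf hf1 hf2 z1 z2 z3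
    (fun x hx => hb x ⟨h01.le.trans hx.1, hx.2⟩)
  have hbl : ∀ x ∈ Set.Icc p1 t, |f3 x| ≤ K :=
    fun x hx => hb x ⟨by linarith [hx.1], by linarith [hx.2]⟩
  have hbr : ∀ x ∈ Set.Icc t p2, |f3 x| ≤ K :=
    fun x hx => hb x ⟨by linarith [hx.1], by linarith [hx.2]⟩
  have h0 : 0 < h := by linarith
  rw [abs_le] at n1 m1 n2 m2
  refine ⟨?_, ?_, ?_⟩
  · rcases le_total (t - p1) (p2 - t) with hc | hc
    · have a := my_A1 ht1 hf2 hbl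
      have : K * (t - p1) ≤ K * (h / 2) := mul_le_mul_of_nonneg_left (by linarith) hK
      rw [abs_le] at a ⊢
      constructor <;> linarith
    · have a := my_A1 ht2.le hf2 hbr
      have : K * (p2 - t) ≤ K * (h / 2) := mul_le_mul_of_nonneg_left (by linarith) hK
      rw [abs_le] at a ⊢
      constructor <;> linarith
  · have a := my_A2 ht2.le hf1 hf2 hbr
    have b := my_B2 ht1 hf1 hf2 hbl
    rw [abs_le] at a b
    obtain ⟨u, hu⟩ : ∃ u, u = t - p1 := ⟨_, rfl⟩
    obtain ⟨v, hv⟩ : ∃ v, v = p2 - t := ⟨_, rfl⟩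
    rw [← hu] at b
    rw [← hv] at a
    have u0 : 0 ≤ u := by linarith
    have v0 : 0 < v := by linarith
    have huv : 0 < u + v := by linarith
    have e : u * v ≤ h ^ 2 / 4 := by nlinarith [sq_nonneg (u - v)]
    have k : K * (u * v) * (u + v) ≤ K * (h ^ 2 / 4) * (u + v) :=
      mul_le_mul_of_nonneg_right (mul_le_mul_of_nonneg_left e hK) huv.le
    have q1 := mul_le_mul_of_nonneg_left a.1 u0
    have q2 := mul_le_mul_of_nonneg_left a.2 u0
    have q3 := mul_le_mul_of_nonneg_left b.1 v0.le
    have q4 := mul_le_mul_of_nonneg_left b.2 v0.le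
    have r1 := mul_le_mul_of_nonneg_left n1.1 v0.le
    have r2 := mul_le_mul_of_nonneg_left n1.2 v0.le
    have r3 := mul_le_mul_of_nonneg_left n2.1 u0
    have r4 := mul_le_mul_of_nonneg_left n2.2 u0
    rw [abs_le]; constructor
    · refine le_of_mul_le_mul_right ?_ huv
      linarith
    · refine le_of_mul_le_mul_right ?_ huv
      linarith
  · rcases ht1.eq_or_lt with rfl | ht1
    · rw [z1]; simp; positivity
    · obtain ⟨ξ, hξ, e⟩ := my_interp h01 ht1 ht2 hf hf1 hf2 z0 z1 z2
      have hx := hb ξ ⟨hξ.1, hξ.2.trans h23.le⟩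
      have hw : |(t - p0) * (t - p1) * (t - p2)| ≤ 2 / 5 * h ^ 3 := by
        have : |(t - p0) * (t - p1) * (t - p2)| = (t - p0) * ((t - p1) * (p2 - t)) := by
          rw [abs_of_nonpos]
          · ring
          · exact mul_nonpos_of_nonneg_of_nonpos
              (mul_nonneg (by linarith) (by linarith)) (by linarith)
        rw [this]
        obtain ⟨x, hx⟩ : ∃ x, x = t - p1 := ⟨_, rfl⟩
        have x0 : 0 < x := by linarith
        calc (t - p0) * ((t - p1) * (p2 - t)) ≤ (x + h) * (x * (h - x)) := by
              rw [← hx]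
              apply mul_le_mul (by linarith) _ _ (by linarith)
              · exact mul_le_mul_of_nonneg_left (by linarith) x0.le
              · exact mul_nonneg x0.le (by linarith)
          _ ≤ 2 / 5 * h ^ 3 := by
              nlinarith [mul_nonneg (by linarith : 0 ≤ x + 2 * (h * (577/1000)))
                (sq_nonneg (x - h * (577/1000))), pow_pos h0 3, mul_pos x0 (pow_pos h0 2),
                mul_nonneg (by linarith : 0 ≤ h - x) (pow_pos h0 2).le]
      have : 6 * |f t| = |f3 ξ| * |(t - p0) * (t - p1) * (t - p2)| := by
        rw [← abs_mul, e, abs_mul]; norm_num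
      have h2 := mul_le_mul hx hw (abs_nonneg _) hK
      linarith

theorem my_flat {f f1 f2 : ℝ → ℝ} {c M η L : ℝ} (hL : 0 < L)
    (hf : ∀ x, HasDerivAt f (f1 x) x) (hf1 : ∀ x, HasDerivAt f1 (f2 x) x)
    (h0 : ∀ x, 0 ≤ f x) (hc : ∀ x, f x ≤ c) (hb : ∀ x, |f2 x| ≤ M)
    (hη : c + M * L ^ 2 / 2 ≤ η * L) (t : ℝ) : |f1 t| ≤ η := by
  have a := my_A2 (p := t) (q := t + L) (K := M) (by linarith) hf hf1 (fun x _ => hb x)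
  have e : t + L - t = L := by ring
  rw [e, abs_le] at a
  have := h0 t
  have := hc t
  have := h0 (t + L)
  have := hc (t + L)
  rw [abs_le]; constructor
  · refine le_of_mul_le_mul_right ?_ hL
    linarith
  · refine le_of_mul_le_mul_right ?_ hL
    linarith

set_option maxHeartbeats 1000000 in
theorem stmt7 (c1 c2 c3 : ℝ)
    (hc1 : 0 < c1) (hc12 : c1 < c2) (hc3 : 0 < c3) (hc32 : c3 < c2) :
    ∃ ε0 > (0:ℝ), ∀ ε : ℝ, 0 ≤ ε → ε < ε0 →
    ∀ a α φ β : ℝ → ℝ,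
    ContDiff ℝ 1 a → ContDiff ℝ 1 α →
    ContDiff ℝ 3 φ → ContDiff ℝ 3 β →
    (∀ t, c1 ≤ a t) → (∀ t, a t ≤ c2) →
    (∀ t, c1 ≤ deriv φ t) → (∀ t, deriv φ t ≤ c2) →
    (∀ t, |deriv (deriv φ) t| ≤ c3) →
    (∀ t, |deriv a t| ≤ ε * deriv φ t) →
    (∀ t, |deriv (deriv (deriv φ)) t| ≤ ε * deriv φ t) →
    (∀ t, c1 ≤ a t + α t) → (∀ t, a t + α t ≤ c2) →
    (∀ t, c1 ≤ deriv φ t + deriv β t) → (∀ t, deriv φ t + deriv β t ≤ c2) →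
    (∀ t, |deriv (deriv φ) t + deriv (deriv β) t| ≤ c3) →
    (∀ t, |deriv a t + deriv α t| ≤ ε * (deriv φ t + deriv β t)) →
    (∀ t, |deriv (deriv (deriv φ)) t + deriv (deriv (deriv β)) t|
        ≤ ε * (deriv φ t + deriv β t)) →
    Function.Surjective φ →
    (∀ t, a t * Real.cos (φ t) = (a t + α t) * Real.cos (φ t + β t)) →
    (∀ (n : ℤ) (tn : ℝ), φ tn = (n + 1/2) * π → β tn = 0) →
    ∀ t, |deriv (deriv β) t| ≤ 2 * π * ε ∧
         |deriv β t| ≤ 2 * π * ε / c1 ∧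
         |β t| ≤ 2 * π * ε / c1 ^ 2 := by
  have hc2 : 0 < c2 := hc1.trans hc12
  have hpi := Real.pi_pos
  obtain ⟨η, hη⟩ : ∃ η, η = c1 ^ 2 / (200 * π) := ⟨_, rfl⟩
  have hη0 : 0 < η := by rw [hη]; positivity
  obtain ⟨L, hL⟩ : ∃ L, L = 2 * c2 / η := ⟨_, rfl⟩
  have hL0 : 0 < L := by rw [hL]; positivity
  refine ⟨min (c1 ^ 3 / (200 * c2 * π ^ 2)) (1 / L ^ 2), by positivity, ?_⟩
  intro ε hε hεlt a α φ β _ _ hφ hβ _ _ hφ1 hφ1' _ _ hφ3 _ _ hψ1 hψ1' _ _ hψ3 hsurj _ hz t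
  have hε1 := hεlt.trans_le (min_le_left _ _)
  have hε2 := hεlt.trans_le (min_le_right _ _)
  rw [lt_div_iff₀ (by positivity)] at hε1 hε2
  have D : ∀ g : ℝ → ℝ, ContDiff ℝ 3 g → (∀ x, HasDerivAt g (deriv g x) x) ∧
      (∀ x, HasDerivAt (deriv g) (deriv (deriv g) x) x) ∧
      (∀ x, HasDerivAt (deriv (deriv g)) (deriv (deriv (deriv g)) x) x) := by
    intro g hg
    have h1 : ContDiff ℝ 2 (deriv g) := by
      have : ContDiff ℝ (2 + 1) g := by convert hg using 1; norm_num
      exact (contDiff_succ_iff_deriv.1 this).2.2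
    have h2 : ContDiff ℝ 1 (deriv (deriv g)) := by
      have : ContDiff ℝ (1 + 1) (deriv g) := by convert h1 using 1; norm_num
      exact (contDiff_succ_iff_deriv.1 this).2.2
    exact ⟨fun x => (hg.differentiable (by norm_num) x).hasDerivAt,
      fun x => (h1.differentiable (by norm_num) x).hasDerivAt,
      fun x => (h2.differentiable (by norm_num) x).hasDerivAt⟩
  obtain ⟨dφ, dφ1, dφ2⟩ := D φ hφ
  obtain ⟨dβ, dβ1, dβ2⟩ := D β hβ
  have hmono : StrictMono φ := strictMono_of_deriv_pos (fun x => hc1.trans_le (hφ1 x))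
  have hβ3 : ∀ x, |deriv (deriv (deriv β)) x| ≤ ε * (2 * deriv φ x + deriv β x) := by
    intro x
    have h1 := abs_le.1 (hφ3 x)
    have h2 := abs_le.1 (hψ3 x)
    rw [abs_le]; constructor <;> linarith
  -- nodes
  have nodes : ∀ t, ∃ p0 p1 p2 p3, p0 < p1 ∧ p1 < p2 ∧ p2 < p3 ∧ p1 ≤ t ∧ t < p2 ∧
      β p0 = 0 ∧ β p1 = 0 ∧ β p2 = 0 ∧ β p3 = 0 ∧
      φ p1 - φ p0 = π ∧ φ p2 - φ p1 = π ∧ φ p3 - φ p2 = π := by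
    intro t
    obtain ⟨n, hn⟩ : ∃ n : ℤ, n = ⌊φ t / π - 1 / 2⌋ := ⟨_, rfl⟩
    have l1 : (n : ℝ) ≤ φ t / π - 1 / 2 := by rw [hn]; exact Int.floor_le _
    have l2 : φ t / π - 1 / 2 < n + 1 := by rw [hn]; exact Int.lt_floor_add_one _
    have l1' : ((n : ℝ) + 1 / 2) * π ≤ φ t := by
      rw [← le_div_iff₀ hpi]; linarith
    have l2' : φ t < ((n : ℝ) + 1 + 1 / 2) * π := by
      rw [← div_lt_iff₀ hpi]; linarith
    obtain ⟨p0, e0⟩ := hsurj ((((n - 1 : ℤ) : ℝ) + 1 / 2) * π)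
    obtain ⟨p1, e1⟩ := hsurj (((n : ℝ) + 1 / 2) * π)
    obtain ⟨p2, e2⟩ := hsurj ((((n + 1 : ℤ) : ℝ) + 1 / 2) * π)
    obtain ⟨p3, e3⟩ := hsurj ((((n + 2 : ℤ) : ℝ) + 1 / 2) * π)
    have z0 := hz _ _ e0
    have z1 := hz _ _ e1
    have z2 := hz _ _ e2
    have z3 := hz _ _ e3
    push_cast at e0 e2 e3
    refine ⟨p0, p1, p2, p3, hmono.lt_iff_lt.1 ?_, hmono.lt_iff_lt.1 ?_, hmono.lt_iff_lt.1 ?_,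
      hmono.le_iff_le.1 ?_, hmono.lt_iff_lt.1 ?_, z0, z1, z2, z3, ?_, ?_, ?_⟩ <;> linarith
  have gap : ∀ p q m, p ≤ q → φ q - φ p = π → 0 < m → (∀ x ∈ Set.Icc p q, m ≤ deriv φ x) →
      q - p ≤ π / m := by
    intro p q m hpq he hm hx
    have := my_T1 (K := -m) hpq (my_neg dφ) (fun x hx' => by linarith [hx x hx'])
    rw [le_div_iff₀ hm]
    linarith
  -- crude bound
  have crude : ∀ t, |deriv β t| ≤ c1 / 100 := by
    intro t
    obtain ⟨p0, p1, p2, p3, h01, h12, h23, ht1, ht2, z0, z1, z2, z3, d1, d2, d3⟩ := nodes t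
    obtain ⟨-, r, -⟩ := my_local (K := ε * (2 * c2)) (h := π / c1) (by positivity) h01 h12 h23
      (gap _ _ _ h01.le d1 hc1 (fun x _ => hφ1 x)) (gap _ _ _ h12.le d2 hc1 (fun x _ => hφ1 x))
      (gap _ _ _ h23.le d3 hc1 (fun x _ => hφ1 x)) ht1 ht2 dβ dβ1 dβ2 z0 z1 z2 z3
      (fun x _ => (hβ3 x).trans (mul_le_mul_of_nonneg_left
        (by linarith [hφ1' x, hψ1' x]) hε))
    refine r.trans ?_
    have : ε * (2 * c2) * (π / c1) ^ 2 * (7 / 24) = (ε * (200 * c2 * π ^ 2)) / c1 ^ 2 / 100 * (7 / 24) := by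
      field_simp; ring
    rw [this]
    have h3 : (ε * (200 * c2 * π ^ 2)) / c1 ^ 2 ≤ c1 := by
      rw [div_le_iff₀ (by positivity)]; nlinarith
    have h4 : 0 ≤ (ε * (200 * c2 * π ^ 2)) / c1 ^ 2 := by positivity
    linarith
  have flat : ∀ s, |deriv (deriv φ) s| ≤ η := by
    refine my_flat (M := ε * c2) (c := c2) hL0 dφ1 dφ2 (fun x => hc1.le.trans (hφ1 x)) hφ1'
      (fun x => (hφ3 x).trans (mul_le_mul_of_nonneg_left (hφ1' x) hε)) ?_
    have : η * L = 2 * c2 := by rw [hL]; field_simp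
    rw [this]
    nlinarith
  -- fine pass
  obtain ⟨p0, p1, p2, p3, h01, h12, h23, ht1, ht2, z0, z1, z2, z3, d1, d2, d3⟩ := nodes t
  have G1 := gap _ _ _ h01.le d1 hc1 (fun x _ => hφ1 x)
  have G2 := gap _ _ _ h12.le d2 hc1 (fun x _ => hφ1 x)
  have G3 := gap _ _ _ h23.le d3 hc1 (fun x _ => hφ1 x)
  obtain ⟨w, hw⟩ : ∃ w, w = deriv φ t := ⟨_, rfl⟩
  have hwc : c1 ≤ w := by rw [hw]; exact hφ1 t
  have w0 : 0 < w := hc1.trans_le hwc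
  have hηc : η * (2 * (π / c1)) = c1 / 100 := by rw [hη]; field_simp; ring
  have near : ∀ x ∈ Set.Icc p0 p3, |deriv φ x - w| ≤ w / 100 := by
    intro x hx
    rcases le_total x t with hc | hc
    · have := my_A1 hc dφ1 (fun y _ => flat y)
      rw [abs_sub_comm, hw]
      rw [← hw]
      have h5 : η * (t - x) ≤ η * (2 * (π / c1)) :=
        mul_le_mul_of_nonneg_left (by linarith [hx.1]) hη0.le
      rw [hw] at hwc ⊢
      linarith
    · have := my_A1 hc dφ1 (fun y _ => flat y)
      have h5 : η * (x - t) ≤ η * (2 * (π / c1)) :=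
        mul_le_mul_of_nonneg_left (by linarith [hx.2]) hη0.le
      rw [hw] at hwc ⊢
      linarith
  have hm : 0 < 99 / 100 * w := by positivity
  have low : ∀ x ∈ Set.Icc p0 p3, 99 / 100 * w ≤ deriv φ x := fun x hx => by
    have := abs_le.1 (near x hx)
    linarith
  obtain ⟨r2, r1, r0⟩ := my_local (K := ε * (203 / 100 * w)) (h := π / (99 / 100 * w))
    (by positivity) h01 h12 h23
    (gap _ _ _ h01.le d1 hm (fun x hx => low x ⟨hx.1, by linarith [hx.2]⟩))
    (gap _ _ _ h12.le d2 hm (fun x hx => low x ⟨by linarith [hx.1], by linarith [hx.2]⟩))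
    (gap _ _ _ h23.le d3 hm (fun x hx => low x ⟨by linarith [hx.1], hx.2⟩))
    ht1 ht2 dβ dβ1 dβ2 z0 z1 z2 z3
    (fun x hx => (hβ3 x).trans (mul_le_mul_of_nonneg_left
      (by linarith [(abs_le.1 (near x hx)).2, (abs_le.1 (crude x)).2]) hε))
  have hpi2 : π < 3.15 := Real.pi_lt_d2
  have hpe : 0 ≤ π * ε := by positivity
  refine ⟨r2.trans ?_, r1.trans ?_, r0.trans ?_⟩
  · have : ε * (203 / 100 * w) * (π / (99 / 100 * w)) * (5 / 6) = π * ε * (203 / 99 * (5 / 6)) := by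
      field_simp
    rw [this]
    linarith
  · have : ε * (203 / 100 * w) * (π / (99 / 100 * w)) ^ 2 * (7 / 24)
        = (π * ε * (π * (20300 / 9801 * (7 / 24)))) / w := by
      field_simp; ring
    rw [this]
    refine div_le_div₀ (by positivity) ?_ hc1 hwc
    have h7 : π * (20300 / 9801 * (7 / 24)) ≤ 2 := by
      norm_num at hpi2 ⊢
      linarith
    have h8 := mul_le_mul_of_nonneg_left h7 hpe
    linarith
  · have : ε * (203 / 100 * w) * (π / (99 / 100 * w)) ^ 3 / 15
        = (π * ε * (π ^ 2 * (2030000 / 970299 / 15))) / w ^ 2 := by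
      field_simp; ring
    rw [this]
    refine div_le_div₀ (by positivity) ?_ (by positivity) (by gcongr)
    have h6 : π ^ 2 ≤ 3.15 ^ 2 := pow_le_pow_left₀ hpi.le hpi2.le 2
    have h7 : π ^ 2 * (2030000 / 970299 / 15) ≤ 2 := by
      norm_num at h6 ⊢
      linarith
    have h8 := mul_le_mul_of_nonneg_left h7 hpe
    linarith
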